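/- Let D ⊆ {0,1}^n and let f : D → {0,1} be a nonconstant partial Boolean function. Then for every nonempty C ⊆ f⁻¹(1) there exists a probability distribution 𝒟 supported on C together with all sensitive neighbors of points of C such that for every decision tree T, error_𝒟(T, f) ≥ (1 / (2|C| · Sens(f))) · Σ_{x ∈ C} |Sens(f_{π(x)}, x)|, where π(x) is the restriction given by the path followed by x in T. -/

import Mathlib

open Finset

attribute [local instance] Classical.propDecidable

/-- A binary decision tree querying coordinates of type `ι`. -/
inductive DTree (ι : Type) : Type where
  | leaf : Bool → DTree ι
  | node : ι → DTree ι → DTree ι → DTree ι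

namespace DTree

/-- Evaluation of a decision tree on an input. -/
def eval {ι : Type} : DTree ι → (ι → Bool) → Bool
  | .leaf b, _ => b
  | .node i t0 t1, x => if x i then t1.eval x else t0.eval x

/-- The size of a decision tree is its number of leaves. -/
def size {ι : Type} : DTree ι → ℕ
  | .leaf _ => 1
  | .node _ t0 t1 => t0.size + t1.size

/-- The restriction (set of literals) given by the root-to-leaf path followed by `x` in `T`. -/
noncomputable def pathRes {ι : Type} : DTree ι → (ι → Bool) → (ι → Option Bool)
  | .leaf _, _ => fun _ => none
  | .node i t0 t1, x =>
      Function.update (if x i then t1.pathRes x else t0.pathRes x) i (some (x i))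

end DTree

/-- Apply a restriction to an input: coordinates fixed by `ρ` take their fixed value. -/
def override {ι : Type} (ρ : ι → Option Bool) (x : ι → Bool) : ι → Bool :=
  fun i => (ρ i).getD (x i)

/-- The number of literals in a restriction. -/
noncomputable def resSize {ι : Type} [Fintype ι] (ρ : ι → Option Bool) : ℕ :=
  (Finset.univ.filter fun i => (ρ i).isSome).card

/-- A restriction `ρ` is consistent with the input `x`. -/
def Consistent {ι : Type} (ρ : ι → Option Bool) (x : ι → Bool) : Prop :=
  ∀ i b, ρ i = some b → x i = b

/-- `T` computes the partial function (represented by the total function `f`) on domain `D`. -/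
def Computes {ι : Type} (T : DTree ι) (f : (ι → Bool) → Bool) (D : Finset (ι → Bool)) : Prop :=
  ∀ x ∈ D, T.eval x = f x

/-- `DT(f)`: the minimal size of a decision tree computing the partial function `f : D → {0,1}`. -/
noncomputable def DTsize {ι : Type} (f : (ι → Bool) → Bool) (D : Finset (ι → Bool)) : ℕ :=
  sInf {s | ∃ T : DTree ι, Computes T f D ∧ T.size = s}

/-- The domain of the subfunction `f_ρ`: inputs whose `ρ`-override lies in `D`. -/
noncomputable def restrictD {ι : Type} [Fintype ι] (D : Finset (ι → Bool)) (ρ : ι → Option Bool) :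
    Finset (ι → Bool) :=
  Finset.univ.filter fun x => override ρ x ∈ D

/-- The subfunction `f_ρ` of `f` obtained by fixing variables according to `ρ`. -/
def restrictF {ι : Type} (f : (ι → Bool) → Bool) (ρ : ι → Option Bool) : (ι → Bool) → Bool :=
  fun x => f (override ρ x)

/-- The partial function `f : D → {0,1}` is constant on its domain. -/
def IsConstOn {ι : Type} (f : (ι → Bool) → Bool) (D : Finset (ι → Bool)) : Prop :=
  ∀ x ∈ D, ∀ y ∈ D, f x = f y

/-- `Cert(f, x)`: the minimal number of literals of a restriction `ρ` consistent with `x`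
such that `f_ρ` is constant on its domain. -/
noncomputable def Cert {ι : Type} [Fintype ι] (f : (ι → Bool) → Bool) (D : Finset (ι → Bool))
    (x : ι → Bool) : ℕ :=
  sInf {k | ∃ ρ : ι → Option Bool, Consistent ρ x ∧
    IsConstOn (restrictF f ρ) (restrictD D ρ) ∧ resSize ρ = k}

/-- `x` with bit `i` flipped. -/
noncomputable def flipBit {ι : Type} (x : ι → Bool) (i : ι) : ι → Bool :=
  Function.update x i (!(x i))

/-- `Sens(f, x)`: the set of sensitive neighbors of `x` that lie in the domain `D`. -/
noncomputable def sensSet {ι : Type} [Fintype ι] (f : (ι → Bool) → Bool) (D : Finset (ι → Bool))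
    (x : ι → Bool) : Finset (ι → Bool) :=
  D.filter fun y => (∃ i, y = flipBit x i) ∧ f y ≠ f x

/-- `Sens(f)`: the maximum sensitivity of the partial function `f : D → {0,1}`. -/
noncomputable def maxSens {ι : Type} [Fintype ι] (f : (ι → Bool) → Bool)
    (D : Finset (ι → Bool)) : ℕ :=
  D.sup fun x => (sensSet f D x).card

/-- `error_𝒟(T, f) = Pr_{x ∼ 𝒟}[T(x) ≠ f(x)]`, for a distribution given by its
probability mass function `𝒟`. -/
noncomputable def errD {ι : Type} [Fintype ι] (𝒟 : (ι → Bool) → ℝ) (T : DTree ι)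
    (f : (ι → Bool) → Bool) : ℝ :=
  ∑ x : ι → Bool, 𝒟 x * (if T.eval x = f x then 0 else 1)

/-- Every input is consistent with its own path. -/
theorem DTree.consistent_pathRes {ι : Type} (T : DTree ι) (x : ι → Bool) :
    Consistent (T.pathRes x) x := by
  induction T with
  | leaf b => intro i b h; simp [DTree.pathRes] at h
  | node i t0 t1 h0 h1 =>
    intro j b h
    by_cases hj : j = i
    · subst hj
      simpa [DTree.pathRes] using h
    · simp only [DTree.pathRes, Function.update_of_ne hj] at h
      split_ifs at h
      · exact h1 j b h
      · exact h0 j b h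

/-- An input consistent with the path of `x` reaches the same leaf as `x`. -/
theorem DTree.eval_eq_of_consistent {ι : Type} (T : DTree ι) {x y : ι → Bool}
    (h : Consistent (T.pathRes x) y) : T.eval y = T.eval x := by
  induction T with
  | leaf b => rfl
  | node i t0 t1 h0 h1 =>
    have hi : y i = x i := h i (x i) (by simp [DTree.pathRes])
    have key : Consistent (if x i then t1.pathRes x else t0.pathRes x) y := by
      intro j b hb
      by_cases hj : j = i
      · subst hj
        rw [hi]
        split_ifs at hb
        · exact t1.consistent_pathRes x j b hb
        · exact t0.consistent_pathRes x j b hb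
      · exact h j b (by simpa only [DTree.pathRes, Function.update_of_ne hj] using hb)
    simp only [DTree.eval, hi]
    split_ifs with hx
    · exact h1 (by simpa [hx] using key)
    · exact h0 (by simpa [hx] using key)

theorem override_eq_self {ι : Type} {ρ : ι → Option Bool} {x : ι → Bool}
    (h : Consistent ρ x) : override ρ x = x := by
  funext i
  cases hi : ρ i with
  | none => simp [override, hi]
  | some b => simp [override, hi, h i b hi]

/-- A sensitive neighbor of `x` for `f_ρ`, with `ρ` consistent with `x`, is itself consistent
with `ρ` and is a sensitive neighbor of `x` for `f`. -/
theorem consistent_and_mem_sensSet_of_mem_restrict {ι : Type} [Fintype ι]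
    {f : (ι → Bool) → Bool} {D : Finset (ι → Bool)} {ρ : ι → Option Bool} {x y : ι → Bool}
    (hx : Consistent ρ x) (hy : y ∈ sensSet (restrictF f ρ) (restrictD D ρ) x) :
    Consistent ρ y ∧ y ∈ sensSet f D x := by
  obtain ⟨hD, ⟨i, rfl⟩, hf⟩ := mem_filter.1 hy
  replace hD := (mem_filter.1 hD).2
  simp only [restrictF] at hf
  have hc : Consistent ρ (flipBit x i) := by
    cases hi : ρ i with
    | none =>
      intro j b hb
      have hj : j ≠ i := by rintro rfl; simp [hi] at hb
      simpa [flipBit, Function.update_of_ne hj] using hx j b hb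
    | some c =>
      refine absurd (congrArg f ?_) hf
      rw [override_eq_self hx]
      funext j
      by_cases hj : j = i
      · subst hj
        simp [override, hi, hx j c hi]
      · have := congrFun (override_eq_self hx) j
        simpa [override, flipBit, Function.update_of_ne hj] using this
  rw [override_eq_self hc] at hD hf
  rw [override_eq_self hx] at hf
  exact ⟨hc, mem_filter.2 ⟨hD, ⟨i, rfl⟩, hf⟩⟩

/-- The distribution of a uniformly random endpoint of a uniformly random pair `(x, y)` with
`x ∈ C` and `y ∈ S x`. -/
noncomputable def edgeDist {α : Type} (C : Finset α) (S : α → Finset α) (z : α) : ℝ :=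
  (1 / (2 * ∑ x ∈ C, ((S x).card : ℝ))) *
    ∑ x ∈ C, ∑ y ∈ S x, ((if z = x then 1 else 0) + (if z = y then 1 else 0))

theorem edgeDist_nonneg {α : Type} (C : Finset α) (S : α → Finset α) (z : α) :
    0 ≤ edgeDist C S z :=
  mul_nonneg (by positivity)
    (sum_nonneg fun x _ => sum_nonneg fun y _ => by split_ifs <;> norm_num)

theorem sum_edgeDist_mul {α : Type} [Fintype α] (C : Finset α) (S : α → Finset α) (g : α → ℝ) :
    ∑ z, edgeDist C S z * g z =
      (1 / (2 * ∑ x ∈ C, ((S x).card : ℝ))) * ∑ x ∈ C, ∑ y ∈ S x, (g x + g y) := by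
  simp only [edgeDist, mul_assoc, ← mul_sum]
  congr 1
  simp only [sum_mul]
  rw [sum_comm]
  refine sum_congr rfl fun x _ => ?_
  rw [sum_comm]
  refine sum_congr rfl fun y _ => ?_
  simp [add_mul, sum_add_distrib]

theorem errD_edgeDist {ι : Type} [Fintype ι] (C : Finset (ι → Bool))
    (S : (ι → Bool) → Finset (ι → Bool)) (T : DTree ι) (f : (ι → Bool) → Bool) :
    errD (edgeDist C S) T f = (1 / (2 * ∑ x ∈ C, ((S x).card : ℝ))) * ∑ x ∈ C, ∑ y ∈ S x,
      ((if T.eval x = f x then 0 else 1) + (if T.eval y = f y then 0 else 1)) :=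
  sum_edgeDist_mul C S fun z => if T.eval z = f z then 0 else 1

theorem mem_of_edgeDist_ne_zero {α : Type} {C : Finset α} {S : α → Finset α} {z : α}
    (h : edgeDist C S z ≠ 0) : z ∈ C ∨ ∃ x ∈ C, z ∈ S x := by
  obtain ⟨x, hx, h⟩ := exists_ne_zero_of_sum_ne_zero (right_ne_zero_of_mul h)
  obtain ⟨y, hy, h⟩ := exists_ne_zero_of_sum_ne_zero h
  by_cases hzx : z = x
  · exact Or.inl (hzx ▸ hx)
  · by_cases hzy : z = y
    · exact Or.inr ⟨x, hx, hzy ▸ hy⟩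
    · simp [hzx, hzy] at h

/-- Every sensitive pair `(x, y)` not separated by the path of `x` contributes an error of `T`
at `x` or at `y`. -/
theorem card_sensSet_restrict_le {ι : Type} [Fintype ι] (D : Finset (ι → Bool))
    (f : (ι → Bool) → Bool) (T : DTree ι) (x : ι → Bool) :
    ((sensSet (restrictF f (T.pathRes x)) (restrictD D (T.pathRes x)) x).card : ℝ) ≤
      ∑ y ∈ sensSet f D x,
        ((if T.eval x = f x then 0 else 1) + (if T.eval y = f y then 0 else 1) : ℝ) := by
  have hmem := fun y => consistent_and_mem_sensSet_of_mem_restrict (f := f) (D := D) (y := y)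
    (T.consistent_pathRes x)
  rw [card_eq_sum_ones, Nat.cast_sum]
  refine (sum_le_sum fun y hy => ?_).trans
    (sum_le_sum_of_subset_of_nonneg (fun y hy => (hmem y hy).2)
      fun y _ _ => by split_ifs <;> norm_num)
  obtain ⟨hc, hs⟩ := hmem y hy
  have hne : f y ≠ f x := (mem_filter.1 hs).2.2
  rw [T.eval_eq_of_consistent hc]
  split_ifs with h1 h2
  · exact absurd (h2.symm.trans h1) hne
  all_goals norm_num

/-- hard distribution lemma: for a nonconstant partial function
`f : D → {0,1}` and nonempty `C ⊆ f⁻¹(1)`, there is a distribution `𝒟` supported on `C`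
together with all sensitive neighbors of points of `C` such that every decision tree `T` has
`error_𝒟(T, f) ≥ (1 / (2|C| · Sens(f))) · Σ_{x ∈ C} |Sens(f_{π(x)}, x)|`. -/
theorem stmt3 {n : ℕ} (D : Finset (Fin n → Bool)) (f : (Fin n → Bool) → Bool)
    (hnc : ∃ x ∈ D, ∃ y ∈ D, f x ≠ f y)
    (C : Finset (Fin n → Bool)) (hC : ∀ x ∈ C, x ∈ D ∧ f x = true) (hCne : C.Nonempty) :
    ∃ 𝒟 : (Fin n → Bool) → ℝ, (∀ z, 0 ≤ 𝒟 z) ∧ (∑ z, 𝒟 z) = 1 ∧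
      (∀ z, 𝒟 z ≠ 0 → z ∈ C ∪ C.biUnion fun x => sensSet f D x) ∧
      ∀ T : DTree (Fin n),
        (1 / (2 * (C.card : ℝ) * (maxSens f D : ℝ))) *
          ∑ x ∈ C, ((sensSet (restrictF f (T.pathRes x)) (restrictD D (T.pathRes x)) x).card : ℝ)
        ≤ errD 𝒟 T f := by
  rcases (C.sum_nonneg fun x _ => ((sensSet f D x).card.cast_nonneg : (0 : ℝ) ≤ _)).eq_or_lt with
    hE | hE
  · obtain ⟨c, hc⟩ := hCne
    refine ⟨fun z => if z = c then 1 else 0, fun z => by positivity, by simp, fun z hz => ?_,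
      fun T => ?_⟩
    · have : z = c := by simpa using hz
      exact mem_union_left _ (this ▸ hc)
    · have hempty : ∀ x ∈ C, sensSet f D x = ∅ := fun x hx => by
        have := (sum_eq_zero_iff_of_nonneg fun x _ => Nat.cast_nonneg _).1 hE.symm x hx
        simpa using this
      rw [sum_eq_zero fun x hx => le_antisymm
        ((card_sensSet_restrict_le D f T x).trans_eq (by rw [hempty x hx, sum_empty]))
        (Nat.cast_nonneg _), mul_zero]
      exact sum_nonneg fun z _ => by positivity
  · refine ⟨edgeDist C (sensSet f D), edgeDist_nonneg _ _, ?_,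
      fun z hz => mem_union.2 ((mem_of_edgeDist_ne_zero hz).imp_right mem_biUnion.2), fun T => ?_⟩
    · have := sum_edgeDist_mul C (sensSet f D) 1
      simp only [Pi.one_apply, mul_one, sum_const, nsmul_eq_mul, ← sum_mul] at this
      rw [this]
      field_simp
      norm_num
    · rw [errD_edgeDist]
      have hle : ∑ x ∈ C, ((sensSet f D x).card : ℝ) ≤ C.card * maxSens f D := by
        rw [← nsmul_eq_mul]
        refine sum_le_card_nsmul _ _ _ fun x hx => ?_
        have hsup : (sensSet f D x).card ≤ maxSens f D :=
          le_sup (f := fun x => (sensSet f D x).card) (hC x hx).1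
        exact_mod_cast hsup
      refine mul_le_mul (one_div_le_one_div_of_le (by positivity) (by linarith))
        (sum_le_sum fun x _ => card_sensSet_restrict_le D f T x)
        (sum_nonneg fun x _ => Nat.cast_nonneg _) (by positivity)
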